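/- arXiv:1709.04102 — 5 statements merged into one kernel-verified Lean document; each statement's English description precedes it below -/
import Mathlib

section
/- Let S₀ be any subset of S¹ and suppose that P₀ : S₀ → [0,1] is Lipschitz continuous with constant L with respect to the norm ‖·‖_w. Then the associated drift F satisfies ‖F(s) − F(s')‖_w ≤ sqrt(12(4L² + 7)) · ‖s − s'‖_w for all s, s' ∈ S₀; i.e., F is Lipschitz continuous on S₀ with constant sqrt(12(4L² + 7)). -/
open MeasureTheory Filter Topology

/-- Weighted ℓ² norm: ‖x‖_w = sqrt(∑ |x_i|²/2^i). -/
noncomputable def wnorm (x : ℕ → ℝ) : ℝ :=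
  Real.sqrt (∑' i : ℕ, |x i| ^ 2 / 2 ^ i)

/-- Membership in S¹: s ∈ [0,1]^{ℤ≥0}, s₀ = 1, nonincreasing, summable. -/
def memS1 (s : ℕ → ℝ) : Prop :=
  s 0 = 1 ∧ (∀ i, 0 ≤ s i ∧ s i ≤ 1) ∧ (∀ i, s (i + 1) ≤ s i) ∧ Summable s

/-- The drift F of the fluid model associated with the function P₀. -/
noncomputable def drift (lam : ℝ) (P0 : (ℕ → ℝ) → ℝ) (s : ℕ → ℝ) : ℕ → ℝ
  | 0 => 0
  | 1 => lam * (1 - P0 s) + lam * (1 - s 1) * P0 s - (s 1 - s 2)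
  | (i + 2) => lam * (s (i + 1) - s (i + 2)) * P0 s - (s (i + 2) - s (i + 3))

/-- A fluid solution: takes values in S¹ (in particular s₀(t) = 1), is continuous
with respect to ‖·‖_w on [0,∞), and for a.e. t ≥ 0 each coordinate i ≥ 1 is
differentiable at t with derivative F_i(s(t)). -/
def IsFluidSolution (lam : ℝ) (P0 : (ℕ → ℝ) → ℝ) (s : ℝ → ℕ → ℝ) : Prop :=
  (∀ t, 0 ≤ t → memS1 (s t)) ∧
  (∀ t, 0 ≤ t → ∀ ε > (0 : ℝ), ∃ δ > (0 : ℝ), ∀ u, 0 ≤ u → |u - t| < δ →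
      wnorm (fun i => s u i - s t i) < ε) ∧
  ∃ Z : Set ℝ, volume Z = 0 ∧
    ∀ t, 0 ≤ t → t ∉ Z → ∀ i, 1 ≤ i →
      HasDerivAt (fun u => s u i) (drift lam P0 (s t) i) t

/-- P₀ in the High Memory regime. -/
noncomputable def P0HighMemory (lam mu : ℝ) (s : ℕ → ℝ) : ℝ :=
  max (1 - mu * (1 - s 1) / lam) 0

/-- P₀ in the High Message regime. -/
noncomputable def P0HighMessage (lam : ℝ) (s : ℕ → ℝ) : ℝ :=
  if s 1 = 1 then max (1 - (1 - s 2) / lam) 0 else 0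

/-- P₀ in the Constrained regime (with the convention 0⁰ = 1). -/
noncomputable def P0Constrained (lam mu : ℝ) (c : ℕ) (s : ℕ → ℝ) : ℝ :=
  (∑ k ∈ Finset.range (c + 1), (mu * (1 - s 1) / lam) ^ k)⁻¹

/-- A four-term Cauchy-Schwarz bound for one coordinate of a drift increment. -/
theorem sq_drift_increment_le {p q : ℝ} (hp0 : 0 ≤ p) (hp1 : p ≤ 1) (hq : q ^ 2 ≤ 1)
    (a b c D : ℝ) :
    (p * (a - b) + q * D - b + c) ^ 2 ≤ 4 * (a ^ 2 + 4 * b ^ 2 + c ^ 2 + D ^ 2) := by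
  have hcs : (p * (a - b) + q * D - b + c) ^ 2 ≤
      4 * ((p * a) ^ 2 + ((1 + p) * b) ^ 2 + c ^ 2 + (q * D) ^ 2) := by
    nlinarith [sq_nonneg (p * a + (1 + p) * b), sq_nonneg (p * a - c),
      sq_nonneg (p * a - q * D), sq_nonneg ((1 + p) * b + c),
      sq_nonneg ((1 + p) * b + q * D), sq_nonneg (c - q * D)]
  have ha : (p * a) ^ 2 ≤ a ^ 2 := by
    rw [mul_pow]; exact mul_le_of_le_one_left (sq_nonneg a) (pow_le_one₀ hp0 hp1)
  have hb : ((1 + p) * b) ^ 2 ≤ 4 * b ^ 2 := by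
    rw [mul_pow]; exact mul_le_mul_of_nonneg_right (by nlinarith) (sq_nonneg b)
  have hD : (q * D) ^ 2 ≤ D ^ 2 := by
    rw [mul_pow]; exact mul_le_of_le_one_left (sq_nonneg D) hq
  linarith

/-- The squared increment of a positive-index drift coordinate is controlled by the neighbouring
coordinate increments and the increment of `P0`. -/
theorem sq_drift_sub_le {lam : ℝ} (hlam0 : 0 ≤ lam) (hlam1 : lam ≤ 1) {P0 : (ℕ → ℝ) → ℝ}
    {s s' : ℕ → ℝ} (hs : memS1 s) (hs' : memS1 s') (hP : 0 ≤ P0 s ∧ P0 s ≤ 1) (j : ℕ) :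
    (drift lam P0 s (j + 1) - drift lam P0 s' (j + 1)) ^ 2 ≤
      4 * ((s j - s' j) ^ 2 + 4 * (s (j + 1) - s' (j + 1)) ^ 2 +
        (s (j + 2) - s' (j + 2)) ^ 2 + (P0 s - P0 s') ^ 2) := by
  have hp0 : 0 ≤ lam * P0 s := mul_nonneg hlam0 hP.1
  have hp1 : lam * P0 s ≤ 1 := mul_le_one₀ hlam1 hP.1 hP.2
  have hq : ∀ r : ℝ, 0 ≤ r → r ≤ 1 → (lam * r) ^ 2 ≤ 1 := fun r h0 h1 =>
    pow_le_one₀ (mul_nonneg hlam0 h0) (mul_le_one₀ hlam1 h0 h1)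
  obtain ⟨h0', hI', hm', -⟩ := hs'
  cases j with
  | zero =>
    have h := sq_drift_increment_le hp0 hp1
      (q := -(lam * s' 1)) (by rw [neg_sq]; exact hq _ (hI' 1).1 (hI' 1).2)
      (s 0 - s' 0) (s 1 - s' 1) (s 2 - s' 2) (P0 s - P0 s')
    refine le_trans (le_of_eq ?_) h
    simp only [drift, hs.1, h0']
    ring
  | succ i =>
    have h := sq_drift_increment_le hp0 hp1
      (q := lam * (s' (i + 1) - s' (i + 2)))
      (hq _ (sub_nonneg.2 (hm' (i + 1))) (by linarith [(hI' (i + 1)).2, (hI' (i + 2)).1]))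
      (s (i + 1) - s' (i + 1)) (s (i + 2) - s' (i + 2)) (s (i + 3) - s' (i + 3)) (P0 s - P0 s')
    refine le_trans (le_of_eq ?_) h
    simp only [drift]
    ring

/-- The series defining the weighted norm of a difference of elements of `S¹` converges. -/
theorem summable_wnorm_sub {s s' : ℕ → ℝ} (hs : memS1 s) (hs' : memS1 s') :
    Summable fun i => (s i - s' i) ^ 2 / 2 ^ i := by
  refine Summable.of_nonneg_of_le (fun i => by positivity) (fun i => ?_)
    summable_geometric_two
  rw [one_div, inv_pow, ← one_div]
  have h1 := hs.2.1 i
  have h2 := hs'.2.1 i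
  have : (s i - s' i) ^ 2 ≤ 1 := by rw [sq_le_one_iff_abs_le_one, abs_le]; constructor <;> linarith
  gcongr

/-- If P₀ is [0,1]-valued and Lipschitz with constant L on S₀ ⊆ S¹
(w.r.t. ‖·‖_w), then the drift F is Lipschitz on S₀ with constant sqrt(12(4L²+7)). -/
theorem drift_lipschitz (lam L : ℝ) (hlam0 : 0 < lam) (hlam1 : lam < 1)
    (S0 : Set (ℕ → ℝ)) (hS0 : ∀ s ∈ S0, memS1 s)
    (P0 : (ℕ → ℝ) → ℝ)
    (hP0range : ∀ s ∈ S0, 0 ≤ P0 s ∧ P0 s ≤ 1)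
    (hLip : ∀ s ∈ S0, ∀ s' ∈ S0, |P0 s - P0 s'| ≤ L * wnorm (fun i => s i - s' i)) :
    ∀ s ∈ S0, ∀ s' ∈ S0,
      wnorm (fun i => drift lam P0 s i - drift lam P0 s' i) ≤
        Real.sqrt (12 * (4 * L ^ 2 + 7)) * wnorm (fun i => s i - s' i) := by
  intro s hs s' hs'
  have hS := hS0 s hs
  have hS' := hS0 s' hs'
  have hD := hLip s hs s' hs'
  simp only [wnorm, sq_abs] at hD ⊢
  set u : ℕ → ℝ := fun i => (s i - s' i) ^ 2 / 2 ^ i with hu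
  set D := P0 s - P0 s' with hDdef
  set f : ℕ → ℝ := fun i => (drift lam P0 s i - drift lam P0 s' i) ^ 2 / 2 ^ i with hf
  have hsum : Summable u := summable_wnorm_sub hS hS'
  have hu0 : ∀ i, 0 ≤ u i := fun i => by positivity
  have hN : 0 ≤ ∑' i, u i := tsum_nonneg hu0
  have hD2 : D ^ 2 ≤ L ^ 2 * ∑' i, u i := by
    have := pow_le_pow_left₀ (abs_nonneg D) hD 2
    rwa [sq_abs, mul_pow, Real.sq_sqrt hN] at this
  have hsum1 : Summable fun j => u (j + 1) := (summable_nat_add_iff 1).2 hsum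
  have hsum2 : Summable fun j => u (j + 2) := (summable_nat_add_iff 2).2 hsum
  have hbound : HasSum (fun j => 2 * u j + 16 * u (j + 1) + 8 * u (j + 2) + 2 * D ^ 2 * (1 / 2) ^ j)
      (2 * (∑' j, u j) + 16 * (∑' j, u (j + 1)) + 8 * (∑' j, u (j + 2)) + 2 * D ^ 2 * 2) :=
    (((hsum.hasSum.mul_left 2).add (hsum1.hasSum.mul_left 16)).add
      (hsum2.hasSum.mul_left 8)).add (hasSum_geometric_two.mul_left (2 * D ^ 2))
  have hle : ∀ j, f (j + 1) ≤
      2 * u j + 16 * u (j + 1) + 8 * u (j + 2) + 2 * D ^ 2 * (1 / 2) ^ j := fun j => by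
    have h := sq_drift_sub_le hlam0.le hlam1.le hS hS' (hP0range s hs) j
    have h2 : f (j + 1) ≤ _ := div_le_div_of_nonneg_right h (by positivity : (0 : ℝ) ≤ 2 ^ (j + 1))
    refine h2.trans (le_of_eq ?_)
    simp only [hu, one_div, inv_pow, pow_succ (2 : ℝ)]
    field_simp
    ring
  have hf1 : Summable fun j => f (j + 1) :=
    Summable.of_nonneg_of_le (fun j => by positivity) hle hbound.summable
  have hf0 : f 0 = 0 := by simp [hf, drift]
  have hfle : ∑' i, f i ≤
      2 * (∑' j, u j) + 16 * (∑' j, u (j + 1)) + 8 * (∑' j, u (j + 2)) + 2 * D ^ 2 * 2 := by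
    rw [((summable_nat_add_iff 1).1 hf1).tsum_eq_zero_add, hf0, zero_add]
    exact hasSum_le hle hf1.hasSum hbound
  have hs1 := hsum.tsum_eq_zero_add
  have hs2 := hsum1.tsum_eq_zero_add
  rw [← Real.sqrt_mul (by positivity)]
  apply Real.sqrt_le_sqrt
  have hL : 0 ≤ L ^ 2 * ∑' i, u i := mul_nonneg (sq_nonneg L) hN
  linarith [hu0 0, hu0 1]
end

section
/- In the Constrained regime, the fluid model has a unique equilibrium s* ∈ S¹ (i.e., a unique point with F_i(s*) = 0 for all i ≥ 1), given by s*_i = λ (λ P₀*)^{i−1} for all i ≥ 1, where P₀* = [∑_{k=0}^c (μ(1−λ)/λ)^k]^{-1}. -/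
open MeasureTheory Filter Topology

/-- A summable sequence whose drift vanishes in every coordinate `i ≥ 1` has `s 1 = lam` and
is geometric from then on, whatever the function `P0`. -/
theorem eq_geometric_of_drift_eq_zero {lam : ℝ} {P0 : (ℕ → ℝ) → ℝ} {s : ℕ → ℝ}
    (hs : Summable s) (h : ∀ i, 1 ≤ i → drift lam P0 s i = 0) (i : ℕ) :
    s (i + 1) = lam * (lam * P0 s) ^ i := by
  have hconst : ∀ i, lam * P0 s * s (i + 1) - s (i + 2) = lam * P0 s * s 1 - s 2 := by
    intro i
    induction i with
    | zero => rfl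
    | succ i ih =>
      have hi : lam * (s (i + 1) - s (i + 2)) * P0 s - (s (i + 2) - s (i + 3)) = 0 :=
        h (i + 2) (by omega)
      change lam * P0 s * s (i + 2) - s (i + 3) = _
      linarith
  have hlim (k : ℕ) : Tendsto (fun i => s (i + k)) atTop (𝓝 0) :=
    (tendsto_add_atTop_iff_nat k).2 hs.tendsto_atTop_zero
  have hzero : lam * P0 s * s 1 - s 2 = 0 := by
    have ht := ((hlim 1).const_mul (lam * P0 s)).sub (hlim 2)
    simp only [hconst, mul_zero, sub_zero] at ht
    exact tendsto_nhds_unique tendsto_const_nhds ht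
  induction i with
  | zero =>
    have h1 : lam * (1 - P0 s) + lam * (1 - s 1) * P0 s - (s 1 - s 2) = 0 := h 1 le_rfl
    simp only [zero_add, pow_zero, mul_one]
    linarith
  | succ i ih =>
    have hi := hconst i
    rw [ih] at hi
    rw [pow_succ]
    linarith

/-- A finite geometric sum with nonnegative ratio has inverse in `[0, 1]`. -/
theorem inv_geom_sum_mem_Icc {x : ℝ} (hx : 0 ≤ x) (c : ℕ) :
    (∑ k ∈ Finset.range (c + 1), x ^ k)⁻¹ ∈ Set.Icc (0 : ℝ) 1 := by
  have h : 1 ≤ ∑ k ∈ Finset.range (c + 1), x ^ k := by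
    rw [Finset.sum_range_succ']
    simpa using Finset.sum_nonneg fun k _ => pow_nonneg hx (k + 1)
  exact ⟨inv_nonneg.2 (zero_le_one.trans h), inv_le_one_of_one_le₀ h⟩

/-- Unique equilibrium of the fluid model in the Constrained regime. -/
theorem equilibrium_constrained (lam mu : ℝ) (c : ℕ)
    (hlam0 : 0 < lam) (hlam1 : lam < 1) (hmu : 0 < mu) (hc : 1 ≤ c) :
    let P0star : ℝ := (∑ k ∈ Finset.range (c + 1), (mu * (1 - lam) / lam) ^ k)⁻¹
    let sstar : ℕ → ℝ := fun i => if i = 0 then 1 else lam * (lam * P0star) ^ (i - 1)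
    memS1 sstar ∧
    (∀ i, 1 ≤ i → drift lam (P0Constrained lam mu c) sstar i = 0) ∧
    (∀ s : ℕ → ℝ, memS1 s →
      (∀ i, 1 ≤ i → drift lam (P0Constrained lam mu c) s i = 0) → s = sstar) := by
  intro P0star sstar
  obtain ⟨hp0, hp1⟩ : P0star ∈ Set.Icc (0 : ℝ) 1 :=
    inv_geom_sum_mem_Icc (div_nonneg (mul_nonneg hmu.le (sub_nonneg.2 hlam1.le)) hlam0.le) c
  have hr0 : 0 ≤ lam * P0star := mul_nonneg hlam0.le hp0
  have hr1 : lam * P0star < 1 := (mul_le_of_le_one_right hlam0.le hp1).trans_lt hlam1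
  have hsucc (i : ℕ) : sstar (i + 1) = lam * (lam * P0star) ^ i := by simp [sstar]
  have hP0 (s : ℕ → ℝ) (h1 : s 1 = lam) : P0Constrained lam mu c s = P0star := by
    simp only [P0Constrained, h1, P0star]
  have hnonneg (i : ℕ) : 0 ≤ sstar i := by
    cases i with
    | zero => exact zero_le_one
    | succ i => rw [hsucc]; exact mul_nonneg hlam0.le (pow_nonneg hr0 i)
  have hanti (i : ℕ) : sstar (i + 1) ≤ sstar i := by
    cases i with
    | zero => simpa [sstar] using hlam1.le
    | succ i =>
      rw [hsucc, hsucc]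
      exact mul_le_mul_of_nonneg_left (pow_le_pow_of_le_one hr0 hr1.le i.le_succ) hlam0.le
  refine ⟨⟨rfl, fun i => ⟨hnonneg i, antitone_nat_of_succ_le hanti i.zero_le⟩, hanti, ?_⟩,
    fun i hi => ?_, fun s hs h => ?_⟩
  · rw [← summable_nat_add_iff 1]
    simpa only [hsucc] using (summable_geometric_of_lt_one hr0 hr1).mul_left lam
  · have hP := hP0 sstar (by simp [sstar])
    match i, hi with
    | 1, _ => simp only [drift, hP, hsucc 0, hsucc 1]; ring
    | i + 2, _ => simp only [drift, hP, hsucc i, hsucc (i + 1), hsucc (i + 2)]; ring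
  · have hgeom := eq_geometric_of_drift_eq_zero hs.2.2.2 h
    have hP := hP0 s (by simpa using hgeom 0)
    funext i
    cases i with
    | zero => exact hs.1
    | succ i => rw [hgeom, hP, hsucc]
end

section
/- In the High Memory regime, the fluid model has a unique equilibrium s* ∈ S¹ (i.e., a unique point with F_i(s*) = 0 for all i ≥ 1), given by s*_i = λ (λ P₀*)^{i−1} for all i ≥ 1, where P₀* = max{1 − μ(1−λ)/λ, 0}. -/
open MeasureTheory Filter Topology

/-- At an equilibrium, `s (i + 2) - lam * P₀ * s (i + 1)` does not depend on `i`. -/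
theorem sub_mul_eq_of_drift_eq_zero {lam : ℝ} {P0 : (ℕ → ℝ) → ℝ} {s : ℕ → ℝ}
    (h : ∀ i, 1 ≤ i → drift lam P0 s i = 0) (i : ℕ) :
    s (i + 2) - lam * P0 s * s (i + 1) = s 1 - lam := by
  induction i with
  | zero =>
    have h1 := h 1 le_rfl
    simp only [drift] at h1
    linarith
  | succ i ih =>
    have h2 := h (i + 2) (by omega)
    simp only [drift] at h2
    linarith

/-- An equilibrium in `S¹` has `s 1 = lam`, whatever the function `P₀`. -/
theorem apply_one_eq_of_drift_eq_zero {lam : ℝ} {P0 : (ℕ → ℝ) → ℝ} {s : ℕ → ℝ}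
    (hs : memS1 s) (h : ∀ i, 1 ≤ i → drift lam P0 s i = 0) : s 1 = lam := by
  have hlim := hs.2.2.2.tendsto_atTop_zero
  have hlim' := ((tendsto_add_atTop_iff_nat 2).2 hlim).sub
    (((tendsto_add_atTop_iff_nat 1).2 hlim).const_mul (lam * P0 s))
  simp only [sub_mul_eq_of_drift_eq_zero h, mul_zero, sub_zero] at hlim'
  linarith [tendsto_nhds_unique hlim' tendsto_const_nhds]

/-- An equilibrium in `S¹` is geometric from index `1` on. -/
theorem apply_succ_eq_of_drift_eq_zero {lam : ℝ} {P0 : (ℕ → ℝ) → ℝ} {s : ℕ → ℝ}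
    (hs : memS1 s) (h : ∀ i, 1 ≤ i → drift lam P0 s i = 0) (i : ℕ) :
    s (i + 1) = lam * (lam * P0 s) ^ i := by
  have h1 := apply_one_eq_of_drift_eq_zero hs h
  induction i with
  | zero => simpa using h1
  | succ i ih =>
    have h2 := sub_mul_eq_of_drift_eq_zero h i
    rw [ih] at h2
    rw [pow_succ]
    linarith

theorem memS1_geometric {a q : ℝ} (ha0 : 0 ≤ a) (ha1 : a ≤ 1) (hq0 : 0 ≤ q) (hq1 : q < 1) :
    memS1 (fun i => if i = 0 then 1 else a * q ^ (i - 1)) := by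
  refine ⟨by simp, fun i => ?_, fun i => ?_, ?_⟩
  · rcases i with _ | i
    · simp
    · simp only [Nat.add_eq_zero_iff, one_ne_zero, and_false, if_false, Nat.add_sub_cancel]
      exact ⟨by positivity, mul_le_one₀ ha1 (by positivity) (pow_le_one₀ hq0 hq1.le)⟩
  · rcases i with _ | i
    · simpa using ha1
    · simp only [Nat.add_eq_zero_iff, one_ne_zero, and_false, if_false, Nat.add_sub_cancel]
      exact mul_le_mul_of_nonneg_left (pow_le_pow_of_le_one hq0 hq1.le i.le_succ) ha0
  · rw [← summable_nat_add_iff 1]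
    simpa using (summable_geometric_of_lt_one hq0 hq1).mul_left a

theorem drift_geometric_eq_zero {lam : ℝ} {P0 : (ℕ → ℝ) → ℝ} {s : ℕ → ℝ}
    (h : ∀ i, s (i + 1) = lam * (lam * P0 s) ^ i) {i : ℕ} (hi : 1 ≤ i) :
    drift lam P0 s i = 0 := by
  obtain _ | _ | i := i
  · omega
  · simp only [drift, h 0, h 1]
    ring
  · simp only [drift, h i, h (i + 1), h (i + 2)]
    ring

/-- Unique equilibrium of the fluid model in the High Memory regime. -/
theorem equilibrium_highMemory (lam mu : ℝ)
    (hlam0 : 0 < lam) (hlam1 : lam < 1) (hmu : 0 < mu) :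
    let P0star : ℝ := max (1 - mu * (1 - lam) / lam) 0
    let sstar : ℕ → ℝ := fun i => if i = 0 then 1 else lam * (lam * P0star) ^ (i - 1)
    memS1 sstar ∧
    (∀ i, 1 ≤ i → drift lam (P0HighMemory lam mu) sstar i = 0) ∧
    (∀ s : ℕ → ℝ, memS1 s →
      (∀ i, 1 ≤ i → drift lam (P0HighMemory lam mu) s i = 0) → s = sstar) := by
  intro P0star sstar
  have hP0 : 0 ≤ P0star := le_max_right _ _
  have hP1 : P0star ≤ 1 := by
    have : 0 ≤ mu * (1 - lam) / lam :=
      div_nonneg (mul_nonneg hmu.le (sub_nonneg.2 hlam1.le)) hlam0.le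
    exact max_le (by linarith) zero_le_one
  have hP {s : ℕ → ℝ} (hs : s 1 = lam) : P0HighMemory lam mu s = P0star := by
    simp only [P0HighMemory, hs, P0star]
  refine ⟨memS1_geometric hlam0.le hlam1.le (mul_nonneg hlam0.le hP0)
    ((mul_le_of_le_one_right hlam0.le hP1).trans_lt hlam1), fun i hi => ?_, fun s hs h => ?_⟩
  · refine drift_geometric_eq_zero (fun j => ?_) hi
    rw [hP (by simp [sstar])]
    simp [sstar]
  · funext i
    obtain _ | i := i
    · simpa [sstar] using hs.1
    · rw [apply_succ_eq_of_drift_eq_zero hs h i, hP (apply_one_eq_of_drift_eq_zero hs h)]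
      simp [sstar]
end

section
/- Fix α > 0 and an integer c ≥ 1. Then for every λ ∈ (0,1), λ [1 − λ + ∑_{k=1}^c (α/λ)^k]^{-1} ≤ [∑_{k=1}^c α^k]^{-1}. In particular, the asymptotic delay of the Resource Constrained Pull-Based policy is upper bounded uniformly over all λ < 1. -/
open MeasureTheory Filter Topology

/-- Uniform (in λ < 1) upper bound on the asymptotic delay of the
Resource Constrained Pull-Based policy. -/
theorem delay_uniform_bound (alpha : ℝ) (c : ℕ) (halpha : 0 < alpha) (hc : 1 ≤ c) :
    ∀ lam : ℝ, 0 < lam → lam < 1 →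
      lam * (1 - lam + ∑ k ∈ Finset.Icc 1 c, (alpha / lam) ^ k)⁻¹ ≤
        (∑ k ∈ Finset.Icc 1 c, alpha ^ k)⁻¹ := by
  intro lam hlam0 hlam1
  have hpos : 0 < ∑ k ∈ Finset.Icc 1 c, alpha ^ k :=
    Finset.sum_pos (fun k _ => pow_pos halpha k) (Finset.nonempty_Icc.2 hc)
  have hle : ∑ k ∈ Finset.Icc 1 c, alpha ^ k ≤ ∑ k ∈ Finset.Icc 1 c, (alpha / lam) ^ k :=
    Finset.sum_le_sum fun k _ =>
      pow_le_pow_left₀ halpha.le (le_div_self halpha.le hlam0 hlam1.le) k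
  calc lam * (1 - lam + ∑ k ∈ Finset.Icc 1 c, (alpha / lam) ^ k)⁻¹
      ≤ 1 * (∑ k ∈ Finset.Icc 1 c, alpha ^ k)⁻¹ :=
        mul_le_mul hlam1.le (inv_anti₀ hpos (by linarith))
          (inv_nonneg.2 (by linarith)) zero_le_one
    _ = (∑ k ∈ Finset.Icc 1 c, alpha ^ k)⁻¹ := one_mul _
end

section
/- Fix λ ∈ (0,1) and α with 0 < α < λ. Then the asymptotic delay tends, as the memory parameter c → ∞, to a strictly positive limit: lim_{c→∞} λ [1 − λ + ∑_{k=1}^c (α/λ)^k]^{-1} = λ(λ−α)/((1−λ)(λ−α) + α) > 0. In particular, when α < λ the asymptotic delay cannot be driven to 0 by increasing the memory. -/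
open MeasureTheory Filter Topology

/-- The geometric series without its constant term. -/
theorem tendsto_sum_Icc_one_pow {r : ℝ} (h0 : 0 ≤ r) (h1 : r < 1) :
    Tendsto (fun c : ℕ => ∑ k ∈ Finset.Icc 1 c, r ^ k) atTop (𝓝 (r * (1 - r)⁻¹)) := by
  refine ((hasSum_geometric_of_lt_one h0 h1).mul_left r).tendsto_sum_nat.congr fun c => ?_
  rw [← Finset.Ico_add_one_right_eq_Icc, Finset.sum_Ico_eq_sum_range]
  simp [pow_add]

/-- For α < λ the asymptotic delay tends, as c → ∞, to the strictly
positive limit λ(λ−α)/((1−λ)(λ−α)+α); in particular it cannot be driven to 0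
by increasing the memory. -/
theorem delay_limit_alpha_lt_lambda (lam alpha : ℝ)
    (hlam0 : 0 < lam) (hlam1 : lam < 1) (halpha0 : 0 < alpha) (halpha : alpha < lam) :
    Tendsto (fun c : ℕ =>
        lam * (1 - lam + ∑ k ∈ Finset.Icc 1 c, (alpha / lam) ^ k)⁻¹)
      atTop (nhds (lam * (lam - alpha) / ((1 - lam) * (lam - alpha) + alpha))) ∧
    0 < lam * (lam - alpha) / ((1 - lam) * (lam - alpha) + alpha) := by
  have hden : 0 < (1 - lam) * (lam - alpha) + alpha := by
    have := mul_pos (sub_pos.2 hlam1) (sub_pos.2 halpha)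
    linarith
  refine ⟨?_, div_pos (mul_pos hlam0 (sub_pos.2 halpha)) hden⟩
  have hne : lam - alpha ≠ 0 := (sub_pos.2 halpha).ne'
  have hsum := tendsto_sum_Icc_one_pow (div_pos halpha0 hlam0).le ((div_lt_one hlam0).2 halpha)
  have hratio : alpha / lam * (1 - alpha / lam)⁻¹ = alpha / (lam - alpha) := by
    rw [one_sub_div hlam0.ne']
    field_simp
  rw [hratio] at hsum
  have hval : 1 - lam + alpha / (lam - alpha) =
      ((1 - lam) * (lam - alpha) + alpha) / (lam - alpha) := by
    field_simp
  have hadd := hsum.const_add (1 - lam)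
  rw [hval] at hadd
  have hlim := (hadd.inv₀ (div_ne_zero hden.ne' hne)).const_mul lam
  rwa [inv_div, ← mul_div_assoc] at hlim
end
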